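/- Let Ω ⊆ (0,1)^d be a set of finite perimeter with dist(Ω, ∂D) > 0, where D = (0,1)^d. Then for every ε > 0, the nonlocal perimeter Per_ε(Ω) := (2/ε^{d+1}) ∫_Ω ∫_{D∖Ω} 1_{‖x−y‖≤ε} dx dy satisfies Per_ε(Ω) ≤ σ_d · Per(Ω), where Per(Ω) is the relative perimeter of Ω in D and σ_d = ∫_{‖z‖≤1}|z_1| dz. -/

import Mathlib

open MeasureTheory Filter Metric Finset ProbabilityTheory
open scoped ENNReal NNReal Topology Classical BigOperators RealInnerProductSpace

noncomputable section

/-- Euclidean space `ℝ^d`. -/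
abbrev Euc (d : ℕ) := EuclideanSpace ℝ (Fin d)

/-- The open unit cube `D = (0,1)^d`. -/
def unitCube (d : ℕ) : Set (Euc d) := {x | ∀ i, x i ∈ Set.Ioo (0:ℝ) 1}

/-- The surface tension `σ_d = ∫_{‖z‖ ≤ 1} |z_1| dz`. -/
def sigmad (d : ℕ) [NeZero d] : ℝ := ∫ z in closedBall (0 : Euc d) 1, |z 0|

/-- `α_d`, the volume of the unit ball in `ℝ^d`. -/
def alphad (d : ℕ) : ℝ := (volume (closedBall (0 : Euc d) 1)).toReal

/-- Divergence of a vector field. -/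
def divg {d : ℕ} (v : Euc d → Euc d) (x : Euc d) : ℝ :=
  ∑ i, fderiv ℝ v x (EuclideanSpace.single i 1) i

/-- The set of values `∫_Ω div v` over admissible test vector fields on `D`. -/
def perimSet (d : ℕ) (Ω : Set (Euc d)) : Set ℝ :=
  {P | ∃ v : Euc d → Euc d, ContDiff ℝ (⊤ : ℕ∞) v ∧ HasCompactSupport v ∧
        tsupport v ⊆ unitCube d ∧ (∀ x ∈ unitCube d, ‖v x‖ ≤ 1) ∧
        P = ∫ x in Ω, divg v x}

/-- Relative perimeter of `Ω` in `D = (0,1)^d` (BV sense). -/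
def relPerim (d : ℕ) (Ω : Set (Euc d)) : ℝ := sSup (perimSet d Ω)

/-- `Ω` has finite relative perimeter in `D`. -/
def HasFinitePerimeter (d : ℕ) (Ω : Set (Euc d)) : Prop := BddAbove (perimSet d Ω)

/-- Nonlocal perimeter `Per_ε(Ω) = (2/ε^{d+1}) ∫_Ω ∫_{D\Ω} 1_{‖x−y‖≤ε}`. -/
def nlPerim (d : ℕ) (ε : ℝ) (Ω : Set (Euc d)) : ℝ :=
  (2 / ε ^ (d + 1)) * ∫ x in Ω, ∫ y in unitCube d \ Ω, (if dist x y ≤ ε then (1:ℝ) else 0)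

/-- The kernel `φ_ε(x,y) = ε^{-(d+1)} 1_{‖x−y‖≤ε} |1_Ω(x) − 1_Ω(y)|`. -/
def phie (d : ℕ) (ε : ℝ) (Ω : Set (Euc d)) (x y : Euc d) : ℝ :=
  (if dist x y ≤ ε then (1:ℝ) else 0) / ε ^ (d + 1) *
    |Set.indicator Ω (fun _ => (1:ℝ)) x - Set.indicator Ω (fun _ => (1:ℝ)) y|

/-- `φ̄_ε(x) = ∫_D φ_ε(x,y) dy`. -/
def phibar (d : ℕ) (ε : ℝ) (Ω : Set (Euc d)) (x : Euc d) : ℝ :=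
  ∫ y in unitCube d, phie d ε Ω x y

/-- The graph perimeter `GPer_{n,ε}(Ω) = (2/(n(n−1))) Σ_{i<j} φ_ε(x_i,x_j)`. -/
def GPer (d n : ℕ) (ε : ℝ) (Ω : Set (Euc d)) (xs : Fin n → Euc d) : ℝ :=
  (2 / ((n:ℝ) * ((n:ℝ) - 1))) *
    ∑ i : Fin n, ∑ j : Fin n, if i < j then phie d ε Ω (xs i) (xs j) else 0

/-- `Ω` has a smooth boundary: it is the sublevel set of a smooth function
with nonvanishing gradient on the boundary. -/
def HasSmoothBoundary {d : ℕ} (Ω : Set (Euc d)) : Prop :=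
  ∃ f : Euc d → ℝ, ContDiff ℝ (⊤ : ℕ∞) f ∧ Ω = {x | f x < 0} ∧
    ∀ x ∈ frontier Ω, fderiv ℝ f x ≠ 0

/-- Volume of the spherical cap `B_d(0,1) ∩ {x : x_d ≥ t}`. -/
def capVol (d : ℕ) [NeZero d] (t : ℝ) : ℝ :=
  (volume (closedBall (0 : Euc d) 1 ∩
    {x : Euc d | t ≤ x ⟨d - 1, Nat.sub_lt (Nat.pos_of_neZero d) one_pos⟩})).toReal

/-- The constant `C_d = 2 ∫_0^1 |B_d(0,1) ∩ {x_d ≥ t}|² dt`. -/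
def Cd (d : ℕ) [NeZero d] : ℝ := 2 * ∫ t in Set.Ioo (0:ℝ) 1, (capVol d t) ^ 2

/-- Perimeter as Hausdorff measure of the boundary, `H^{d−1}(∂Ω)`. -/
def perimH (d : ℕ) (Ω : Set (Euc d)) : ℝ := (μH[(d:ℝ) - 1] (frontier Ω)).toReal

/-- The rate `f(n,ε)` from the moment estimates. -/
def frate (d n : ℕ) (ε : ℝ) : ℝ :=
  if (n:ℝ) ^ (-(1:ℝ)/(d:ℝ)) ≤ ε then 1 / Real.sqrt ((n:ℝ) * ε)
  else 1 / ((n:ℝ) * ε ^ (((d:ℝ) + 1)/2))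


theorem setIntegral_abs_clm_closedBall (d : ℕ) [NeZero d] (L : Euc d →L[ℝ] ℝ) {ε : ℝ}
    (hε : 0 < ε) :
    ∫ h in closedBall (0 : Euc d) ε, |L h| = ε ^ (d + 1) * sigmad d * ‖L‖ := by
  have hunit : ∫ h in closedBall (0 : Euc d) 1, |L h| = sigmad d * ‖L‖ := by
    set u : Euc d := (InnerProductSpace.toDual ℝ (Euc d)).symm L with hu
    have hnu : ‖u‖ = ‖L‖ := by simp [hu]
    have hL : ∀ h, L h = ⟪u, h⟫ := fun h => by simp [hu]
    set R := (Submodule.span ℝ {‖L‖ • EuclideanSpace.single (0 : Fin d) (1 : ℝ) - u})ᗮ.reflection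
    have hRu : R (‖L‖ • EuclideanSpace.single (0 : Fin d) (1 : ℝ)) = u :=
      Submodule.reflection_sub (by simp [norm_smul, hnu])
    have key := R.measurePreserving.setIntegral_preimage_emb
      R.toHomeomorph.measurableEmbedding (fun h => |L h|) (closedBall 0 1)
    have hpre : R ⁻¹' closedBall 0 1 = closedBall 0 1 := by ext; simp
    rw [← key, hpre, sigmad, ← integral_mul_const]
    refine integral_congr_ae (Eventually.of_forall fun h => ?_)
    simp only [hL]
    rw [← hRu, R.inner_map_map, real_inner_smul_left, abs_mul, abs_norm, mul_comm,
      EuclideanSpace.inner_single_left]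
    simp
  have hsc := Measure.setIntegral_comp_smul_of_pos volume (fun h : Euc d => |L h|)
    (closedBall 0 1) hε
  rw [_root_.smul_closedBall _ _ zero_le_one] at hsc
  simp only [smul_zero, map_smul, smul_eq_mul, abs_mul, abs_of_pos hε, integral_const_mul, hunit,
    Real.norm_eq_abs, mul_one, finrank_euclideanSpace_fin] at hsc
  rw [eq_inv_mul_iff_mul_eq₀ (by positivity)] at hsc
  rw [← hsc]
  ring

theorem setLIntegral_enorm_clm_closedBall (d : ℕ) [NeZero d] (L : Euc d →L[ℝ] ℝ) {ε : ℝ}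
    (hε : 0 < ε) :
    ∫⁻ h in closedBall (0 : Euc d) ε, ‖L h‖ₑ = ENNReal.ofReal (ε ^ (d + 1) * sigmad d) * ‖L‖ₑ := by
  have hint : IntegrableOn (fun h => L h) (closedBall (0 : Euc d) ε) :=
    L.continuous.continuousOn.integrableOn_compact (isCompact_closedBall _ _)
  rw [← ofReal_integral_norm_eq_lintegral_enorm hint]
  simp only [Real.norm_eq_abs]
  rw [setIntegral_abs_clm_closedBall d L hε, ENNReal.ofReal_mul' (norm_nonneg _), ofReal_norm]

theorem enorm_sub_le_lintegral_fderiv {E : Type*} [NormedAddCommGroup E] [NormedSpace ℝ E]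
    {F : E → ℝ} (hF : ContDiff ℝ 1 F) (x h : E) :
    ‖F (x + h) - F x‖ₑ ≤ ∫⁻ t in Set.Ioc (0 : ℝ) 1, ‖fderiv ℝ F (x + t • h) h‖ₑ := by
  have hd : ∀ t ∈ Set.uIcc (0 : ℝ) 1,
      HasDerivAt (fun t : ℝ => F (x + t • h)) (fderiv ℝ F (x + t • h) h) t := fun t _ => by
    have h1 : HasDerivAt (fun t : ℝ => x + t • h) h t := by
      simpa using ((hasDerivAt_id t).smul_const h).const_add x
    exact ((hF.differentiable (by simp)).differentiableAt.hasFDerivAt).comp_hasDerivAt t h1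
  have hc : Continuous fun t : ℝ => fderiv ℝ F (x + t • h) h :=
    ((hF.continuous_fderiv (by simp)).comp (by fun_prop)).clm_apply continuous_const
  have := intervalIntegral.integral_eq_sub_of_hasDerivAt hd (hc.intervalIntegrable _ _)
  simp only [one_smul, zero_smul, add_zero] at this
  rw [← this, intervalIntegral.integral_of_le zero_le_one]
  exact enorm_integral_le_lintegral_enorm _

theorem lintegral_translate_sub_le (d : ℕ) [NeZero d] {F : Euc d → ℝ} (hF : ContDiff ℝ 1 F)
    {ε : ℝ} (hε : 0 < ε) :
    ∫⁻ h in closedBall (0 : Euc d) ε, ∫⁻ x, ‖F (x + h) - F x‖ₑ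
      ≤ ENNReal.ofReal (ε ^ (d + 1) * sigmad d) * ∫⁻ x, ‖fderiv ℝ F x‖ₑ := by
  have hF' : Continuous (fderiv ℝ F) := hF.continuous_fderiv (by simp)
  calc ∫⁻ h in closedBall (0 : Euc d) ε, ∫⁻ x, ‖F (x + h) - F x‖ₑ
      ≤ ∫⁻ h in closedBall (0 : Euc d) ε, ∫⁻ x, ‖fderiv ℝ F x h‖ₑ := by
        refine lintegral_mono fun h => ?_
        calc ∫⁻ x, ‖F (x + h) - F x‖ₑ
            ≤ ∫⁻ x, ∫⁻ t in Set.Ioc (0 : ℝ) 1, ‖fderiv ℝ F (x + t • h) h‖ₑ :=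
              lintegral_mono fun x => enorm_sub_le_lintegral_fderiv hF x h
          _ = ∫⁻ t in Set.Ioc (0 : ℝ) 1, ∫⁻ x, ‖fderiv ℝ F (x + t • h) h‖ₑ := by
              refine lintegral_lintegral_swap (Continuous.measurable ?_).aemeasurable
              exact ((hF'.comp (by fun_prop)).clm_apply continuous_const).enorm
          _ = ∫⁻ t in Set.Ioc (0 : ℝ) 1, ∫⁻ x, ‖fderiv ℝ F x h‖ₑ := by
              refine lintegral_congr fun t => ?_
              exact lintegral_add_right_eq_self (fun x => ‖fderiv ℝ F x h‖ₑ) (t • h)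
          _ = ∫⁻ x, ‖fderiv ℝ F x h‖ₑ := by simp
    _ = ∫⁻ x, ∫⁻ h in closedBall (0 : Euc d) ε, ‖fderiv ℝ F x h‖ₑ := by
        refine lintegral_lintegral_swap (Continuous.measurable ?_).aemeasurable
        exact ((hF'.comp continuous_snd).clm_apply continuous_fst).enorm
    _ = _ := by
        simp_rw [setLIntegral_enorm_clm_closedBall d _ hε]
        exact lintegral_const_mul _ hF'.enorm.measurable

open ContinuousLinearMap in
theorem fderiv_convolution_apply {d : ℕ} {E : Type*} [NormedAddCommGroup E] [NormedSpace ℝ E]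
    [CompleteSpace E] {φ : Euc d → ℝ} (hφ : ContDiff ℝ 1 φ) (hc : HasCompactSupport φ)
    {g : Euc d → E} (hg : LocallyIntegrable g) (x e : Euc d) :
    fderiv ℝ (convolution φ g (lsmul ℝ ℝ) volume) x e = ∫ y, fderiv ℝ φ (x - y) e • g y := by
  rw [(hc.hasFDerivAt_convolution_left (lsmul ℝ ℝ) hφ hg x).fderiv, convolution_eq_swap]
  have hex : ConvolutionExistsAt (fderiv ℝ φ) g x ((lsmul ℝ ℝ).precompL (Euc d)) volume :=
    (hc.fderiv ℝ).convolutionExists_left _ (hφ.continuous_fderiv (by simp)) hg x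
  rw [integral_apply hex.integrable_swap]
  rfl

open ContinuousLinearMap in
theorem divg_convolution {d : ℕ} {φ : Euc d → ℝ} (hφ : ContDiff ℝ 1 φ)
    (hc : HasCompactSupport φ) {w : Euc d → Euc d} (hw : Integrable w) (x : Euc d) :
    divg (convolution φ w (lsmul ℝ ℝ) volume) x = ∫ y, fderiv ℝ φ (x - y) (w y) := by
  obtain ⟨C, hC⟩ := (hc.fderiv ℝ).exists_bound_of_continuous (hφ.continuous_fderiv (by simp))
  have hint : ∀ e, Integrable fun y => fderiv ℝ φ (x - y) e • w y := fun e => by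
    refine hw.bdd_smul (𝕜 := ℝ) (C * ‖e‖) ?_ (Eventually.of_forall fun y => ?_)
    · exact (((hφ.continuous_fderiv (by simp)).comp (by fun_prop)).clm_apply
        continuous_const).aestronglyMeasurable
    · exact (le_opNorm _ _).trans (by gcongr; exact hC _)
  have hcoord : ∀ i, (∫ y, fderiv ℝ φ (x - y) (EuclideanSpace.single i 1) • w y) i
      = ∫ y, fderiv ℝ φ (x - y) (EuclideanSpace.single i 1) * w y i := fun i => by
    exact ((EuclideanSpace.proj (𝕜 := ℝ) i).integral_comp_comm (hint _)).symm
  simp only [divg, fderiv_convolution_apply hφ hc hw.locallyIntegrable, hcoord]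
  rw [← integral_finsetSum]
  swap
  · exact fun i _ => (EuclideanSpace.proj (𝕜 := ℝ) i).integrable_comp (hint _)
  refine integral_congr_ae (Eventually.of_forall fun y => ?_)
  dsimp only
  conv_rhs => rw [← (EuclideanSpace.basisFun (Fin d) ℝ).sum_repr (w y), map_sum]
  simp [mul_comm]

open ContinuousLinearMap in
theorem integral_mul_divg_convolution {d : ℕ} {φ : Euc d → ℝ} (hφ : ContDiff ℝ 1 φ)
    (hc : HasCompactSupport φ) (heven : ∀ x, φ (-x) = φ x) {f : Euc d → ℝ} (hf : Integrable f)
    {w : Euc d → Euc d} (hw : Integrable w) :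
    ∫ x, f x * divg (convolution φ w (lsmul ℝ ℝ) volume) x
      = -∫ y, fderiv ℝ (convolution φ f (lsmul ℝ ℝ) volume) y (w y) := by
  have hφ' : Continuous (fderiv ℝ φ) := hφ.continuous_fderiv (by simp)
  obtain ⟨C, hC⟩ := (hc.fderiv ℝ).exists_bound_of_continuous hφ'
  have hodd : ∀ x, fderiv ℝ φ (-x) = -fderiv ℝ φ x := fun x => by
    have h1 := ((hφ.differentiable (by simp)).differentiableAt (x := -x)).hasFDerivAt.comp x
      (hasFDerivAt_id x).neg
    have h2 : φ ∘ Neg.neg = φ := funext heven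
    rw [h2] at h1
    rw [h1.fderiv]
    ext
    simp
  have hint : Integrable (fun p : Euc d × Euc d => f p.1 * fderiv ℝ φ (p.1 - p.2) (w p.2))
      (volume.prod volume) := by
    refine ((hf.norm.mul_prod hw.norm).const_mul C).mono' ?_ (Eventually.of_forall fun p => ?_)
    · refine hf.aestronglyMeasurable.comp_fst.mul ?_
      exact (ContinuousLinearMap.id ℝ (Euc d →L[ℝ] ℝ)).aestronglyMeasurable_comp₂
        (hφ'.comp (by fun_prop)).aestronglyMeasurable hw.aestronglyMeasurable.comp_snd
    · rw [norm_mul]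
      calc ‖f p.1‖ * ‖fderiv ℝ φ (p.1 - p.2) (w p.2)‖
          ≤ ‖f p.1‖ * (C * ‖w p.2‖) := by
            gcongr
            exact (le_opNorm _ _).trans (by gcongr; exact hC _)
        _ = C * (‖f p.1‖ * ‖w p.2‖) := by ring
  simp only [divg_convolution hφ hc hw, ← integral_const_mul]
  rw [integral_integral_swap hint, ← integral_neg]
  refine integral_congr_ae (Eventually.of_forall fun y => ?_)
  simp only [fderiv_convolution_apply hφ hc hf.locallyIntegrable, smul_eq_mul, ← integral_neg]
  refine integral_congr_ae (Eventually.of_forall fun x => ?_)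
  simp only
  rw [← neg_sub y x, hodd, neg_apply]
  ring

open ContinuousLinearMap in
theorem norm_convolution_normed_le {d : ℕ} (φ : ContDiffBump (0 : Euc d)) {w : Euc d → Euc d}
    (hw : ∀ x, ‖w x‖ ≤ 1) (x : Euc d) :
    ‖convolution (φ.normed volume) w (lsmul ℝ ℝ) volume x‖ ≤ 1 := by
  rw [← φ.integral_normed (μ := volume)]
  refine norm_integral_le_of_norm_le φ.integrable_normed (Eventually.of_forall fun t => ?_)
  rw [lsmul_apply, norm_smul, Real.norm_of_nonneg (φ.nonneg_normed t)]
  exact mul_le_of_le_one_right (φ.nonneg_normed t) (hw _)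

open ContinuousLinearMap in
theorem support_convolution_normed_subset {d : ℕ} {E : Type*} [NormedAddCommGroup E]
    [NormedSpace ℝ E] (φ : ContDiffBump (0 : Euc d)) (g : Euc d → E) :
    Function.support (convolution (φ.normed volume) g (lsmul ℝ ℝ) volume)
      ⊆ thickening φ.rOut (Function.support g) := by
  refine (support_convolution_subset _).trans ?_
  rintro _ ⟨a, ha, b, hb, rfl⟩
  rw [φ.support_normed_eq] at ha
  exact mem_thickening_iff.2 ⟨b, hb, by simpa using ha⟩

theorem isBounded_unitCube (d : ℕ) : Bornology.IsBounded (unitCube d) := by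
  refine (isBounded_iff_forall_norm_le).2 ⟨√d, fun x hx => ?_⟩
  rw [EuclideanSpace.norm_eq]
  refine Real.sqrt_le_sqrt ?_
  calc ∑ i, ‖x i‖ ^ 2 ≤ ∑ _i : Fin d, (1 : ℝ) := by
        refine Finset.sum_le_sum fun i _ => pow_le_one₀ (norm_nonneg _) ?_
        rw [Real.norm_of_nonneg (hx i).1.le]
        exact (hx i).2.le
    _ = d := by simp

open ContinuousLinearMap in
theorem lintegral_fderiv_convolution_le (d : ℕ) (Ω : Set (Euc d)) (hΩ : MeasurableSet Ω)
    (hsub : Ω ⊆ unitCube d) (hfin : HasFinitePerimeter d Ω) {δ : ℝ}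
    (hthick : thickening δ Ω ⊆ unitCube d) (φ : ContDiffBump (0 : Euc d))
    (hφδ : 2 * φ.rOut < δ) :
    ∫⁻ x, ‖fderiv ℝ (convolution (φ.normed volume) (Ω.indicator fun _ => (1 : ℝ))
      (lsmul ℝ ℝ) volume) x‖ₑ ≤ ENNReal.ofReal (relPerim d Ω) := by
  set f : Euc d → ℝ := Ω.indicator fun _ => (1 : ℝ)
  set F := convolution (φ.normed volume) f (lsmul ℝ ℝ) volume with hF
  have hbdd : Bornology.IsBounded (thickening δ Ω) := (isBounded_unitCube d).subset hthick
  have hpos := φ.rOut_pos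
  have hf : Integrable f :=
    (integrableOn_const ((isBounded_unitCube d).subset hsub).measure_lt_top.ne).integrable_indicator
      hΩ
  have hφsm : ContDiff ℝ (⊤ : ℕ∞) (φ.normed volume) := φ.contDiff_normed
  have hφc : HasCompactSupport (φ.normed volume) := φ.hasCompactSupport_normed
  have hFsm : ContDiff ℝ (⊤ : ℕ∞) F :=
    hφc.contDiff_convolution_left _ hφsm hf.locallyIntegrable
  have hF' : Continuous (fderiv ℝ F) := hFsm.continuous_fderiv (by simp)
  set K := cthickening φ.rOut Ω
  have hKsub : K ⊆ thickening δ Ω := cthickening_subset_thickening' (by linarith) (by linarith) Ω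
  have hKc : IsCompact K :=
    Metric.isCompact_of_isClosed_isBounded isClosed_cthickening (hbdd.subset hKsub)
  have hFK : tsupport F ⊆ K :=
    (closure_mono ((support_convolution_normed_subset φ f).trans
      (thickening_subset_of_subset _ Set.support_indicator_subset))).trans
      (closure_thickening_subset_cthickening _ _)
  have hF'K : Function.support (fderiv ℝ F) ⊆ K := (support_fderiv_subset ℝ).trans hFK
  set w : Euc d → Euc d := fun x => -(‖gradient F x‖⁻¹ • gradient F x) with hw
  have hgrad : Continuous (gradient F) :=
    (InnerProductSpace.toDual ℝ (Euc d)).symm.continuous.comp hF'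
  have hwK : Function.support w ⊆ K := fun x hx => hF'K fun h0 => hx (by simp [hw, gradient, h0])
  have hw1 : ∀ x, ‖w x‖ ≤ 1 := fun x => by
    simp only [hw, norm_neg, norm_smul, norm_inv, norm_norm]
    exact inv_mul_le_one
  have hwint : Integrable w := by
    rw [← integrableOn_iff_integrable_of_support_subset hwK]
    refine Measure.integrableOn_of_bounded hKc.measure_lt_top.ne ?_
      (Eventually.of_forall hw1)
    exact (hgrad.norm.measurable.inv.smul hgrad.measurable).neg.aestronglyMeasurable
  set V := convolution (φ.normed volume) w (lsmul ℝ ℝ) volume with hV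
  have hVsupp : tsupport V ⊆ thickening δ Ω := by
    refine (closure_mono ((support_convolution_normed_subset φ w).trans
      ((thickening_subset_of_subset _ hwK).trans
        (thickening_cthickening_subset _ hpos.le _)))).trans
      ((closure_thickening_subset_cthickening _ _).trans
        (cthickening_subset_thickening' (by linarith) (by linarith) Ω))
  have hmem : ∫ x in Ω, divg V x ∈ perimSet d Ω :=
    ⟨V, hφc.contDiff_convolution_left _ hφsm hwint.locallyIntegrable,
      Metric.isCompact_of_isClosed_isBounded (isClosed_tsupport _) (hbdd.subset hVsupp),
      hVsupp.trans hthick, fun x _ => norm_convolution_normed_le φ hw1 x, rfl⟩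
  have hval : ∫ x, ‖fderiv ℝ F x‖ = ∫ x in Ω, divg V x := by
    have hadj := integral_mul_divg_convolution (hφsm.of_le (by simp)) hφc
      φ.normed_neg hf hwint
    rw [← integral_neg] at hadj
    rw [← integral_indicator hΩ]
    refine (integral_congr_ae (Eventually.of_forall fun x => ?_)).trans
      (hadj.symm.trans (integral_congr_ae (Eventually.of_forall fun x => ?_)))
    · have hx : ∀ h, fderiv ℝ F x h = ⟪gradient F x, h⟫ := fun h => by simp [gradient]
      have hn : ‖fderiv ℝ F x‖ = ‖gradient F x‖ := by simp [gradient]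
      simp only [← hF, hx, hn, hw, inner_neg_right, neg_neg, real_inner_smul_right,
        real_inner_self_eq_norm_sq]
      by_cases h0 : ‖gradient F x‖ = 0
      · simp [h0]
      · field_simp
    · by_cases hx : x ∈ Ω <;> simp [f, hx, hV]
  have hFint : Integrable (fderiv ℝ F) :=
    hF'.integrable_of_hasCompactSupport (HasCompactSupport.intro hKc fun x hx => by
      by_contra h; exact hx (hF'K h))
  rw [← ofReal_integral_norm_eq_lintegral_enorm hFint, hval]
  exact ENNReal.ofReal_le_ofReal (le_csSup hfin hmem)

theorem isOpen_unitCube (d : ℕ) : IsOpen (unitCube d) := by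
  simp only [unitCube, Set.ofPred_forall]
  exact isOpen_iInter_of_finite fun i => isOpen_Ioo.preimage (by fun_prop)

theorem thickening_subset_unitCube {d : ℕ} {Ω : Set (Euc d)} (hsub : Ω ⊆ unitCube d) {δ : ℝ}
    (hsep : ∀ x ∈ Ω, ∀ y ∈ frontier (unitCube d), δ ≤ dist x y) :
    thickening δ Ω ⊆ unitCube d := by
  intro y hy
  obtain ⟨z, hz, hyz⟩ := mem_thickening_iff.1 hy
  have hball : ball z δ ⊆ unitCube d := by
    refine (convex_ball z δ).isPreconnected.subset_left_of_subset_union (isOpen_unitCube d)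
      isClosed_closure.isOpen_compl
      (disjoint_compl_right.mono_left subset_closure) ?_ ?_
    · intro x hx
      by_contra hcon
      simp only [Set.mem_union, Set.mem_compl_iff, not_or, not_not] at hcon
      have hfr : x ∈ frontier (unitCube d) := by
        rw [(isOpen_unitCube d).frontier_eq]
        exact ⟨hcon.2, hcon.1⟩
      exact absurd (hsep z hz x hfr) (not_le.2 (by rwa [dist_comm]))
    · exact ⟨z, mem_ball_self (dist_nonneg.trans_lt hyz), hsub hz⟩
  exact hball hyz

theorem lintegral_translate_sub_le_of_tendsto {d : ℕ} {f : Euc d → ℝ} {F : ℕ → Euc d → ℝ}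
    (hF : ∀ n, Continuous (F n)) (hlim : ∀ᵐ x, Tendsto (fun n => F n x) atTop (𝓝 (f x)))
    (s : Set (Euc d)) {C : ℝ≥0∞}
    (hC : ∀ n, ∫⁻ h in s, ∫⁻ x, ‖F n (x + h) - F n x‖ₑ ≤ C) :
    ∫⁻ h in s, ∫⁻ x, ‖f (x + h) - f x‖ₑ ≤ C := by
  have hmeas : ∀ n, Measurable fun p : Euc d × Euc d => ‖F n (p.2 + p.1) - F n p.2‖ₑ := fun n =>
    (((hF n).comp (by fun_prop)).sub ((hF n).comp (by fun_prop))).enorm.measurable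
  have hstep : ∀ h, ∫⁻ x, ‖f (x + h) - f x‖ₑ
      ≤ liminf (fun n => ∫⁻ x, ‖F n (x + h) - F n x‖ₑ) atTop := fun h => by
    have hlim' := (measurePreserving_add_right volume h).quasiMeasurePreserving.ae hlim
    calc ∫⁻ x, ‖f (x + h) - f x‖ₑ
        = ∫⁻ x, liminf (fun n => ‖F n (x + h) - F n x‖ₑ) atTop := by
          refine lintegral_congr_ae ?_
          filter_upwards [hlim, hlim'] with x h1 h2
          exact (h2.sub h1).enorm.liminf_eq.symm
      _ ≤ _ := lintegral_liminf_le fun n => (hmeas n).comp measurable_prodMk_left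
  calc ∫⁻ h in s, ∫⁻ x, ‖f (x + h) - f x‖ₑ
      ≤ ∫⁻ h in s, liminf (fun n => ∫⁻ x, ‖F n (x + h) - F n x‖ₑ) atTop := lintegral_mono hstep
    _ ≤ liminf (fun n => ∫⁻ h in s, ∫⁻ x, ‖F n (x + h) - F n x‖ₑ) atTop :=
        lintegral_liminf_le fun n => (hmeas n).lintegral_prod_right'
    _ ≤ C := liminf_le_of_frequently_le' (Frequently.of_forall hC)

theorem two_mul_lintegral_le_translate {d : ℕ} {Ω : Set (Euc d)} (hΩ : MeasurableSet Ω)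
    (D : Set (Euc d)) (hD : MeasurableSet D) (ε : ℝ) :
    2 * ∫⁻ x in Ω, ∫⁻ y in D \ Ω, (if dist x y ≤ ε then 1 else 0 : ℝ≥0∞)
      ≤ ∫⁻ h in closedBall (0 : Euc d) ε, ∫⁻ x,
        ‖Ω.indicator (fun _ => (1 : ℝ)) (x + h) - Ω.indicator (fun _ => (1 : ℝ)) x‖ₑ := by
  set f : Euc d → ℝ := Ω.indicator fun _ => (1 : ℝ) with hf
  have hfm : Measurable f := measurable_const.indicator hΩ
  set k : Euc d → Euc d → ℝ≥0∞ := fun x y => if x ∈ Ω ∧ y ∉ Ω ∧ dist x y ≤ ε then 1 else 0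
    with hk
  have hkm : Measurable (Function.uncurry k) := by
    refine Measurable.ite ?_ measurable_const measurable_const
    exact (measurable_fst hΩ).inter ((measurable_snd hΩ).compl.inter
      (measurableSet_le (f := fun p : Euc d × Euc d => dist p.1 p.2) (by fun_prop)
        measurable_const))
  have hJ : ∫⁻ x in Ω, ∫⁻ y in D \ Ω, (if dist x y ≤ ε then 1 else 0 : ℝ≥0∞)
      ≤ ∫⁻ x, ∫⁻ y, k x y := by
    rw [← lintegral_indicator hΩ]
    refine lintegral_mono fun x => Set.indicator_apply_le' (fun hx => ?_) fun _ => zero_le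
    rw [← lintegral_indicator (hD.diff hΩ)]
    refine lintegral_mono fun y => Set.indicator_apply_le' (fun hy => ?_) fun _ => zero_le
    simp [hk, hx, hy.2]
  have hpt : ∀ x h, k x (x + h) + k (x + h) x
      ≤ (closedBall (0 : Euc d) ε).indicator (fun h => ‖f (x + h) - f x‖ₑ) h := fun x h => by
    by_cases hh : ‖h‖ ≤ ε <;> by_cases h1 : x ∈ Ω <;> by_cases h2 : x + h ∈ Ω <;>
      simp [hk, hf, hh, h1, h2, Set.indicator_apply]
  have hgm : Measurable (Function.uncurry fun x h : Euc d =>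
      (closedBall (0 : Euc d) ε).indicator (fun h => ‖f (x + h) - f x‖ₑ) h) := by
    have : Measurable fun p : Euc d × Euc d => ‖f (p.1 + p.2) - f p.1‖ₑ :=
      ((hfm.comp (by fun_prop)).sub (hfm.comp (by fun_prop))).enorm
    exact this.indicator (measurable_snd (measurableSet_closedBall (x := (0 : Euc d)) (ε := ε)))
  calc 2 * ∫⁻ x in Ω, ∫⁻ y in D \ Ω, (if dist x y ≤ ε then 1 else 0 : ℝ≥0∞)
      ≤ (∫⁻ x, ∫⁻ y, k x y) + ∫⁻ x, ∫⁻ y, k y x := by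
        rw [← lintegral_lintegral_swap hkm.aemeasurable, two_mul]
        exact add_le_add hJ hJ
    _ = ∫⁻ x, ∫⁻ y, (k x y + k y x) := by
        refine (lintegral_add_left hkm.lintegral_prod_right' _).symm.trans
          (lintegral_congr fun x => ?_)
        exact (lintegral_add_left (hkm.comp measurable_prodMk_left) _).symm
    _ = ∫⁻ x, ∫⁻ h, (k x (x + h) + k (x + h) x) := by
        refine lintegral_congr fun x => ?_
        exact (lintegral_add_left_eq_self (fun y => k x y + k y x) x).symm
    _ ≤ ∫⁻ x, ∫⁻ h, (closedBall (0 : Euc d) ε).indicator (fun h => ‖f (x + h) - f x‖ₑ) h :=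
        lintegral_mono fun x => lintegral_mono fun h => hpt x h
    _ = ∫⁻ h, ∫⁻ x, (closedBall (0 : Euc d) ε).indicator (fun h => ‖f (x + h) - f x‖ₑ) h :=
        lintegral_lintegral_swap hgm.aemeasurable
    _ = ∫⁻ h in closedBall (0 : Euc d) ε, ∫⁻ x, ‖f (x + h) - f x‖ₑ := by
        rw [← lintegral_indicator measurableSet_closedBall]
        refine lintegral_congr fun h => ?_
        by_cases hh : h ∈ closedBall (0 : Euc d) ε <;> simp only [Set.indicator_of_mem,
          Set.indicator_of_notMem, hh, not_false_eq_true, lintegral_zero]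

/-- `Per_ε(Ω) ≤ σ_d Per(Ω)` for sets of finite perimeter away from `∂D`. -/
theorem nonlocal_le_perimeter (d : ℕ) [NeZero d] (hd : 2 ≤ d)
    (Ω : Set (Euc d)) (hΩ : MeasurableSet Ω) (hsub : Ω ⊆ unitCube d)
    (hfin : HasFinitePerimeter d Ω)
    (δ : ℝ) (hδ : 0 < δ)
    (hsep : ∀ x ∈ Ω, ∀ y ∈ frontier (unitCube d), δ ≤ dist x y) :
    ∀ ε : ℝ, 0 < ε → nlPerim d ε Ω ≤ sigmad d * relPerim d Ω := by
  intro ε hε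
  have hthick := thickening_subset_unitCube hsub hsep
  set f : Euc d → ℝ := Ω.indicator fun _ => (1 : ℝ)
  have hfint : Integrable f :=
    (integrableOn_const ((isBounded_unitCube d).subset hsub).measure_lt_top.ne).integrable_indicator
      hΩ
  let φ : ℕ → ContDiffBump (0 : Euc d) := fun n =>
    ⟨δ / 8 / (n + 1), δ / 4 / (n + 1), by positivity, by gcongr; norm_num⟩
  have hφlim : Tendsto (fun n => (φ n).rOut) atTop (𝓝 0) := by
    have := (tendsto_one_div_add_atTop_nhds_zero_nat (𝕜 := ℝ)).const_mul (δ / 4)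
    simpa [φ, div_eq_mul_inv] using this
  have hφδ : ∀ n, 2 * (φ n).rOut < δ := fun n => by
    have : δ / 4 / ((n : ℝ) + 1) ≤ δ / 4 := div_le_self (by positivity) (by simp)
    change 2 * (δ / 4 / ((n : ℝ) + 1)) < δ
    linarith
  set F : ℕ → Euc d → ℝ := fun n =>
    convolution ((φ n).normed volume) f (ContinuousLinearMap.lsmul ℝ ℝ) volume
  have hFsm : ∀ n, ContDiff ℝ 1 (F n) := fun n =>
    (φ n).hasCompactSupport_normed.contDiff_convolution_left (n := 1) _
      (φ n).contDiff_normed hfint.locallyIntegrable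
  have hlim : ∀ᵐ x, Tendsto (fun n => F n x) atTop (𝓝 (f x)) :=
    ContDiffBump.ae_convolution_tendsto_right_of_locallyIntegrable (K := 2) hφlim
      (Eventually.of_forall fun n => le_of_eq (by simp only [φ]; ring)) hfint.locallyIntegrable
  have hsig : 0 ≤ sigmad d := integral_nonneg fun _ => abs_nonneg _
  have hper : 0 ≤ relPerim d Ω := le_csSup hfin
    ⟨0, contDiff_const, HasCompactSupport.zero, by simp [tsupport], by simp, by simp [divg]⟩
  have hT := lintegral_translate_sub_le_of_tendsto (fun n => (hFsm n).continuous) hlim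
    (closedBall 0 ε) fun n => (lintegral_translate_sub_le d (hFsm n) hε).trans
      (mul_le_mul_right (lintegral_fderiv_convolution_le d Ω hΩ hsub hfin hthick (φ n) (hφδ n)) _)
  have hJ := (two_mul_lintegral_le_translate hΩ (unitCube d)
    (isOpen_unitCube d).measurableSet ε).trans hT
  set I := ∫ x in Ω, ∫ y in unitCube d \ Ω, (if dist x y ≤ ε then (1:ℝ) else 0) with hI
  have hIle : ENNReal.ofReal I
      ≤ ∫⁻ x in Ω, ∫⁻ y in unitCube d \ Ω, (if dist x y ≤ ε then 1 else 0 : ℝ≥0∞) := by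
    refine (Real.ofReal_le_enorm I).trans ((enorm_integral_le_lintegral_enorm _).trans ?_)
    refine lintegral_mono fun x => (enorm_integral_le_lintegral_enorm _).trans ?_
    refine lintegral_mono fun y => ?_
    dsimp only
    split_ifs <;> simp
  have h2I : 2 * I ≤ ε ^ (d + 1) * sigmad d * relPerim d Ω := by
    rw [← ENNReal.ofReal_le_ofReal_iff (by positivity), ENNReal.ofReal_mul (by positivity),
      ENNReal.ofReal_mul (by positivity), ENNReal.ofReal_ofNat]
    exact (mul_le_mul_right hIle 2).trans hJ
  rw [nlPerim, ← hI, div_mul_eq_mul_div, div_le_iff₀ (by positivity)]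
  linarith

end
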